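/- Let Ω be a nonempty bounded open subset of ℝⁿ, let b : Ω → ℝ be twice continuously differentiable with bounded first and second derivatives, set q(x,p) := −(p/2)Δb(x) + (p²/4)|∇b(x)|² and λ₁(p) := λ₁(q(·,p)). Then (1/4)·inf_{x∈Ω}|∇b(x)|² ≤ liminf_{p→∞} λ₁(p)/p² ≤ limsup_{p→∞} λ₁(p)/p² ≤ (1/4)·sup_{x∈Ω}|∇b(x)|². -/

import Mathlib

open MeasureTheory

/-- The Rayleigh quotient `J_q(φ)` on the domain `Ω`. -/
noncomputable def rayleigh {n : ℕ} (Ω : Set (EuclideanSpace ℝ (Fin n)))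
    (q : EuclideanSpace ℝ (Fin n) → ℝ) (φ : EuclideanSpace ℝ (Fin n) → ℝ) : ℝ :=
  (∫ x in Ω, (‖fderiv ℝ φ x‖ ^ 2 + q x * φ x ^ 2)) / (∫ x in Ω, φ x ^ 2)

/-- The variational principal eigenvalue `λ₁(q)`: the infimum of the Rayleigh quotient
over nonzero smooth compactly supported test functions supported in `Ω`. -/
noncomputable def lam1 {n : ℕ} (Ω : Set (EuclideanSpace ℝ (Fin n)))
    (q : EuclideanSpace ℝ (Fin n) → ℝ) : ℝ :=
  sInf (rayleigh Ω q ''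
    {φ | ContDiff ℝ (⊤ : ℕ∞) φ ∧ HasCompactSupport φ ∧ tsupport φ ⊆ Ω ∧ φ ≠ 0})

/-- The Laplacian `Δb(x) = ∑ i, ∂²b/∂xᵢ²(x)`. -/
noncomputable def lap {n : ℕ} (b : EuclideanSpace ℝ (Fin n) → ℝ)
    (x : EuclideanSpace ℝ (Fin n)) : ℝ :=
  ∑ i : Fin n, fderiv ℝ (fun y => fderiv ℝ b y (EuclideanSpace.single i 1)) x
      (EuclideanSpace.single i 1)

/-- `q(x,p) = -(p/2) Δb(x) + (p²/4) |∇b(x)|²`. -/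
noncomputable def qfun {n : ℕ} (b : EuclideanSpace ℝ (Fin n) → ℝ) (p : ℝ)
    (x : EuclideanSpace ℝ (Fin n)) : ℝ :=
  -(p / 2) * lap b x + (p ^ 2 / 4) * ‖fderiv ℝ b x‖ ^ 2


theorem aux_rayleigh {n : ℕ} (Ω : Set (EuclideanSpace ℝ (Fin n)))
    (hΩo : IsOpen Ω) (q φ : EuclideanSpace ℝ (Fin n) → ℝ) (hq : ContinuousOn q Ω)
    (A B : ℝ) (hA : ∀ x ∈ Ω, A ≤ q x) (hB : ∀ x ∈ Ω, q x ≤ B)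
    (h1 : ContDiff ℝ (⊤ : ℕ∞) φ) (h2 : HasCompactSupport φ) (h3 : tsupport φ ⊆ Ω)
    (h4 : φ ≠ 0) :
    A ≤ rayleigh Ω q φ ∧
    rayleigh Ω q φ ≤ (∫ x in Ω, ‖fderiv ℝ φ x‖ ^ 2) / (∫ x in Ω, φ x ^ 2) + B := by
  have hc : Continuous φ := h1.continuous
  have hs : HasCompactSupport (fun x => φ x ^ 2) :=
    h2.comp_left (g := fun t : ℝ => t ^ 2) (by simp)
  have hs' : HasCompactSupport (fun x => ‖fderiv ℝ φ x‖ ^ 2) :=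
    (h2.fderiv ℝ).comp_left
      (g := fun t : EuclideanSpace ℝ (Fin n) →L[ℝ] ℝ => ‖t‖ ^ 2) (by simp)
  have hφ2 : Integrable (fun x => φ x ^ 2) volume :=
    (hc.pow 2).integrable_of_hasCompactSupport hs
  have hd : Continuous (fderiv ℝ φ) := h1.continuous_fderiv (by simp)
  have hd2 : Integrable (fun x => ‖fderiv ℝ φ x‖ ^ 2) volume :=
    (hd.norm.pow 2).integrable_of_hasCompactSupport hs'
  have hq2 : IntegrableOn (fun x => q x * φ x ^ 2) Ω := by
    refine Integrable.bdd_mul (c := max |A| |B|) hφ2.integrableOn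
      (hq.aestronglyMeasurable hΩo.measurableSet) ?_
    filter_upwards [ae_restrict_mem hΩo.measurableSet] with x hx
    exact abs_le_max_abs_abs (hA x hx) (hB x hx)
  have hpos : 0 < ∫ x in Ω, φ x ^ 2 := by
    have he : ∫ x in Ω, φ x ^ 2 = ∫ x, φ x ^ 2 := by
      apply setIntegral_eq_integral_of_forall_compl_eq_zero
      intro x hx
      have : φ x = 0 := by
        by_contra h
        exact hx (h3 (subset_tsupport φ h))
      simp [this]
    rw [he]
    obtain ⟨x, hx⟩ := Function.ne_iff.mp h4
    refine Continuous.integral_pos_of_hasCompactSupport_nonneg_nonzero (x := x) (hc.pow 2)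
      hs (fun x => sq_nonneg _) ?_
    exact pow_ne_zero 2 hx
  have hsum : ∫ x in Ω, (‖fderiv ℝ φ x‖ ^ 2 + q x * φ x ^ 2) =
      (∫ x in Ω, ‖fderiv ℝ φ x‖ ^ 2) + ∫ x in Ω, q x * φ x ^ 2 :=
    integral_add hd2.integrableOn hq2
  have hK : 0 ≤ ∫ x in Ω, ‖fderiv ℝ φ x‖ ^ 2 := integral_nonneg fun x => by positivity
  have hl : A * ∫ x in Ω, φ x ^ 2 ≤ ∫ x in Ω, q x * φ x ^ 2 := by
    rw [← integral_const_mul]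
    exact setIntegral_mono_on (hφ2.integrableOn.const_mul A) hq2 hΩo.measurableSet
      fun x hx => mul_le_mul_of_nonneg_right (hA x hx) (sq_nonneg _)
  have hu : ∫ x in Ω, q x * φ x ^ 2 ≤ B * ∫ x in Ω, φ x ^ 2 := by
    rw [← integral_const_mul]
    exact setIntegral_mono_on hq2 (hφ2.integrableOn.const_mul B) hΩo.measurableSet
      fun x hx => mul_le_mul_of_nonneg_right (hB x hx) (sq_nonneg _)
  unfold rayleigh
  rw [hsum]
  constructor
  · rw [le_div_iff₀ hpos]; linarith
  · rw [div_le_iff₀ hpos, add_mul, div_mul_cancel₀ _ hpos.ne']; linarith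

theorem aux_exists {n : ℕ} (Ω : Set (EuclideanSpace ℝ (Fin n)))
    (hΩne : Ω.Nonempty) (hΩo : IsOpen Ω) :
    ∃ φ : EuclideanSpace ℝ (Fin n) → ℝ,
      ContDiff ℝ (⊤ : ℕ∞) φ ∧ HasCompactSupport φ ∧ tsupport φ ⊆ Ω ∧ φ ≠ 0 := by
  obtain ⟨x, hx⟩ := hΩne
  obtain ⟨f, h1, h2, h3, -, h5⟩ :=
    exists_contDiff_tsupport_subset (n := (⊤ : ℕ∞)) (hΩo.mem_nhds hx)
  refine ⟨f, h3, h2, h1, fun h => ?_⟩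
  rw [h] at h5
  simp at h5

theorem aux_lap {n : ℕ} (Ω : Set (EuclideanSpace ℝ (Fin n))) (hΩo : IsOpen Ω)
    (b : EuclideanSpace ℝ (Fin n) → ℝ) (hb : ContDiffOn ℝ 2 b Ω)
    (hb2 : ∃ M, ∀ x ∈ Ω, ‖fderiv ℝ (fderiv ℝ b) x‖ ≤ M) :
    ContinuousOn (lap b) Ω ∧ ∃ C, ∀ x ∈ Ω, |lap b x| ≤ C := by
  have h1 : ContDiffOn ℝ 1 (fderiv ℝ b) Ω := hb.fderiv_of_isOpen hΩo (by norm_num)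
  have hcont : ContinuousOn (fderiv ℝ (fderiv ℝ b)) Ω :=
    h1.continuousOn_fderiv_of_isOpen hΩo le_rfl
  have heq : ∀ x ∈ Ω, lap b x = ∑ i : Fin n, fderiv ℝ (fderiv ℝ b) x
      (EuclideanSpace.single i 1) (EuclideanSpace.single i 1) := by
    intro x hx
    unfold lap
    refine Finset.sum_congr rfl fun i _ => ?_
    have hd : DifferentiableAt ℝ (fderiv ℝ b) x :=
      (h1.differentiableOn (by norm_num)).differentiableAt (hΩo.mem_nhds hx)
    rw [(hd.hasFDerivAt.clm_apply (hasFDerivAt_const (EuclideanSpace.single i (1 : ℝ)) x)).fderiv]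
    simp
  constructor
  · refine ContinuousOn.congr ?_ heq
    refine continuousOn_finset_sum _ fun i _ => ?_
    exact (hcont.clm_apply continuousOn_const).clm_apply continuousOn_const
  · obtain ⟨M, hM⟩ := hb2
    refine ⟨∑ i : Fin n, M, fun x hx => ?_⟩
    rw [heq x hx]
    refine (Finset.abs_sum_le_sum_abs _ _).trans (Finset.sum_le_sum fun i _ => ?_)
    have h := (fderiv ℝ (fderiv ℝ b) x).le_opNorm₂
      (EuclideanSpace.single i 1) (EuclideanSpace.single i 1)
    simp at h
    exact h.trans (hM x hx)


theorem eigenvalue_quadratic_growth {n : ℕ} (hn : 1 ≤ n)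
    (Ω : Set (EuclideanSpace ℝ (Fin n)))
    (hΩne : Ω.Nonempty) (hΩo : IsOpen Ω) (hΩbd : Bornology.IsBounded Ω)
    (b : EuclideanSpace ℝ (Fin n) → ℝ) (hb : ContDiffOn ℝ 2 b Ω)
    (hb1 : ∃ M, ∀ x ∈ Ω, ‖fderiv ℝ b x‖ ≤ M)
    (hb2 : ∃ M, ∀ x ∈ Ω, ‖fderiv ℝ (fderiv ℝ b) x‖ ≤ M) :
    (1 / 4) * sInf ((fun x => ‖fderiv ℝ b x‖ ^ 2) '' Ω) ≤
      Filter.liminf (fun p : ℝ => lam1 Ω (qfun b p) / p ^ 2) Filter.atTop ∧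
    Filter.liminf (fun p : ℝ => lam1 Ω (qfun b p) / p ^ 2) Filter.atTop ≤
      Filter.limsup (fun p : ℝ => lam1 Ω (qfun b p) / p ^ 2) Filter.atTop ∧
    Filter.limsup (fun p : ℝ => lam1 Ω (qfun b p) / p ^ 2) Filter.atTop ≤
      (1 / 4) * sSup ((fun x => ‖fderiv ℝ b x‖ ^ 2) '' Ω) := by
  obtain ⟨hlc, C, hC⟩ := aux_lap Ω hΩo b hb hb2
  obtain ⟨M, hM⟩ := hb1
  obtain ⟨φ, hφ1, hφ2, hφ3, hφ4⟩ := aux_exists Ω hΩne hΩo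
  set S := (fun x => ‖fderiv ℝ b x‖ ^ 2) '' Ω with hS
  have hSb : BddBelow S := ⟨0, by rintro _ ⟨x, -, rfl⟩; positivity⟩
  have hSa : BddAbove S := ⟨M ^ 2, by
    rintro _ ⟨x, hx, rfl⟩
    exact pow_le_pow_left₀ (norm_nonneg _) (hM x hx) 2⟩
  have hfc : ContinuousOn (fderiv ℝ b) Ω := hb.continuousOn_fderiv_of_isOpen hΩo (by norm_num)
  have hqc : ∀ p, ContinuousOn (qfun b p) Ω := fun p =>
    (continuousOn_const.mul hlc).add (continuousOn_const.mul (hfc.norm.pow 2))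
  have hqA : ∀ p : ℝ, 0 < p → ∀ x ∈ Ω, p ^ 2 / 4 * sInf S - p / 2 * C ≤ qfun b p x := by
    intro p hp x hx
    have h1 : sInf S ≤ ‖fderiv ℝ b x‖ ^ 2 := csInf_le hSb ⟨x, hx, rfl⟩
    have h2 := mul_le_mul_of_nonneg_left h1 (by positivity : 0 ≤ p ^ 2 / 4)
    have h3 := mul_le_mul_of_nonneg_left (abs_le.mp (hC x hx)).2 (by positivity : 0 ≤ p / 2)
    unfold qfun
    linarith
  have hqB : ∀ p : ℝ, 0 < p → ∀ x ∈ Ω, qfun b p x ≤ p ^ 2 / 4 * sSup S + p / 2 * C := by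
    intro p hp x hx
    have h1 : ‖fderiv ℝ b x‖ ^ 2 ≤ sSup S := le_csSup hSa ⟨x, hx, rfl⟩
    have h2 := mul_le_mul_of_nonneg_left h1 (by positivity : 0 ≤ p ^ 2 / 4)
    have h3 := mul_le_mul_of_nonneg_left (abs_le.mp (hC x hx)).1 (by positivity : 0 ≤ p / 2)
    unfold qfun
    linarith
  set K := (∫ x in Ω, ‖fderiv ℝ φ x‖ ^ 2) / (∫ x in Ω, φ x ^ 2) with hK
  have hinv : Filter.Tendsto (fun p : ℝ => p⁻¹) Filter.atTop (nhds 0) := tendsto_inv_atTop_zero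
  have hL : Filter.Tendsto (fun p : ℝ => 1 / 4 * sInf S - C / 2 * p⁻¹) Filter.atTop
      (nhds (1 / 4 * sInf S)) := by
    simpa using (hinv.const_mul (C / 2)).const_sub (1 / 4 * sInf S)
  have hU : Filter.Tendsto (fun p : ℝ => 1 / 4 * sSup S + (C / 2 * p⁻¹ + K * p⁻¹ ^ 2))
      Filter.atTop (nhds (1 / 4 * sSup S)) := by
    simpa using ((hinv.const_mul (C / 2)).add ((hinv.pow 2).const_mul K)).const_add (1 / 4 * sSup S)
  have hlo : (fun p : ℝ => 1 / 4 * sInf S - C / 2 * p⁻¹) ≤ᶠ[Filter.atTop]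
      (fun p : ℝ => lam1 Ω (qfun b p) / p ^ 2) := by
    filter_upwards [Filter.eventually_gt_atTop 0] with p hp
    have h : p ^ 2 / 4 * sInf S - p / 2 * C ≤ lam1 Ω (qfun b p) := by
      refine le_csInf ⟨_, φ, ⟨hφ1, hφ2, hφ3, hφ4⟩, rfl⟩ ?_
      rintro _ ⟨ψ, ⟨k1, k2, k3, k4⟩, rfl⟩
      exact (aux_rayleigh Ω hΩo _ ψ (hqc p) _ _ (hqA p hp) (hqB p hp) k1 k2 k3 k4).1
    rw [le_div_iff₀ (by positivity)]
    refine le_trans (le_of_eq ?_) h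
    field_simp
  have hup : (fun p : ℝ => lam1 Ω (qfun b p) / p ^ 2) ≤ᶠ[Filter.atTop]
      (fun p : ℝ => 1 / 4 * sSup S + (C / 2 * p⁻¹ + K * p⁻¹ ^ 2)) := by
    filter_upwards [Filter.eventually_gt_atTop 0] with p hp
    have h : lam1 Ω (qfun b p) ≤ K + (p ^ 2 / 4 * sSup S + p / 2 * C) := by
      refine le_trans (csInf_le ⟨p ^ 2 / 4 * sInf S - p / 2 * C, ?_⟩
        ⟨φ, ⟨hφ1, hφ2, hφ3, hφ4⟩, rfl⟩)
        (aux_rayleigh Ω hΩo _ φ (hqc p) _ _ (hqA p hp) (hqB p hp) hφ1 hφ2 hφ3 hφ4).2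
      rintro _ ⟨ψ, ⟨k1, k2, k3, k4⟩, rfl⟩
      exact (aux_rayleigh Ω hΩo _ ψ (hqc p) _ _ (hqA p hp) (hqB p hp) k1 k2 k3 k4).1
    rw [div_le_iff₀ (by positivity)]
    refine le_trans h (le_of_eq ?_)
    field_simp
    ring
  have hba := hU.isBoundedUnder_le.mono_le hup
  have hbb := hL.isBoundedUnder_ge.mono_ge hlo
  refine ⟨?_, Filter.liminf_le_limsup hba hbb, ?_⟩
  · rw [← hL.liminf_eq]
    exact Filter.liminf_le_liminf hlo hL.isBoundedUnder_ge hba.isCoboundedUnder_ge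
  · rw [← hU.limsup_eq]
    exact Filter.limsup_le_limsup hup hbb.isCoboundedUnder_le hU.isBoundedUnder_le
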